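/- Let κ be an infinite field and let f ∈ κ[x,y,z] be invariant of weight (1,−1,0). Then for every commutative κ-algebra A, every unit τ ∈ Aˣ, and all tuples a ∈ A^{d₁}, b ∈ A^{d₂}, c ∈ A^{d₃}, the evaluation of f satisfies f(τ·a, τ⁻¹·b, c) = f(a, b, c), where τ·a multiplies every coordinate of a by τ and τ⁻¹·b multiplies every coordinate of b by τ⁻¹. In particular, the invariance of f of weight (1,−1,0) persists under every field extension of κ. -/

import Mathlib

open MvPolynomial

/-- The κ-algebra endomorphism `σ_τ` of `κ[x,y,z]` determined by
`x_i ↦ τ·x_i`, `y_j ↦ τ⁻¹·y_j`, `z_l ↦ z_l`. -/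
noncomputable def weightScaling {κ : Type*} [Field κ] (d₁ d₂ d₃ : ℕ) (τ : κˣ) :
    MvPolynomial (Fin d₁ ⊕ Fin d₂ ⊕ Fin d₃) κ →ₐ[κ]
      MvPolynomial (Fin d₁ ⊕ Fin d₂ ⊕ Fin d₃) κ :=
  MvPolynomial.aeval
    (Sum.elim (fun i => MvPolynomial.C (τ : κ) * MvPolynomial.X (Sum.inl i))
      (Sum.elim
        (fun j => MvPolynomial.C ((τ⁻¹ : κˣ) : κ) * MvPolynomial.X (Sum.inr (Sum.inl j)))
        (fun l => MvPolynomial.X (Sum.inr (Sum.inr l)))))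

theorem aeval_scale_monomial {κ : Type*} [Field κ] (d₁ d₂ d₃ : ℕ)
    {A : Type*} [CommRing A] [Algebra κ A] (t s : A)
    (a : Fin d₁ → A) (b : Fin d₂ → A) (c : Fin d₃ → A)
    (m : (Fin d₁ ⊕ Fin d₂ ⊕ Fin d₃) →₀ ℕ) (r : κ) :
    MvPolynomial.aeval
        (Sum.elim (fun i => t * a i) (Sum.elim (fun j => s * b j) c)) (monomial m r) =
      t ^ (∑ i, m (Sum.inl i)) * s ^ (∑ j, m (Sum.inr (Sum.inl j))) *
        MvPolynomial.aeval (Sum.elim a (Sum.elim b c)) (monomial m r) := by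
  simp only [MvPolynomial.aeval_monomial]
  rw [Finsupp.prod_fintype _ _ (by simp), Finsupp.prod_fintype _ _ (by simp)]
  simp only [Fintype.prod_sum_type, Sum.elim_inl, Sum.elim_inr, mul_pow,
    Finset.prod_mul_distrib, Finset.prod_pow_eq_pow_sum]
  ring

theorem coeff_weightScaling {κ : Type*} [Field κ] (d₁ d₂ d₃ : ℕ) (τ : κˣ)
    (f : MvPolynomial (Fin d₁ ⊕ Fin d₂ ⊕ Fin d₃) κ)
    (m : (Fin d₁ ⊕ Fin d₂ ⊕ Fin d₃) →₀ ℕ) :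
    coeff m (weightScaling d₁ d₂ d₃ τ f) =
      (τ : κ) ^ (∑ i, m (Sum.inl i)) * ((τ⁻¹ : κˣ) : κ) ^ (∑ j, m (Sum.inr (Sum.inl j))) *
        coeff m f := by
  induction f using MvPolynomial.induction_on' with
  | add p q hp hq => rw [map_add, coeff_add, hp, hq, coeff_add, mul_add]
  | monomial n r =>
    have hX : (Sum.elim (fun i => X (Sum.inl i)) (Sum.elim (fun j => X (Sum.inr (Sum.inl j)))
        (fun l => X (Sum.inr (Sum.inr l)))) :
        Fin d₁ ⊕ Fin d₂ ⊕ Fin d₃ → MvPolynomial (Fin d₁ ⊕ Fin d₂ ⊕ Fin d₃) κ) = X := by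
      funext i
      rcases i with i | i | i <;> rfl
    rw [weightScaling, aeval_scale_monomial, hX, aeval_X_left_apply, ← C_pow, ← C_pow, ← C_mul,
      coeff_C_mul]
    by_cases h : n = m
    · subst h; rfl
    · simp [coeff_monomial, h]

theorem exponents_eq {κ : Type*} [Field κ] [Infinite κ] (p q : ℕ)
    (h : ∀ τ : κˣ, (τ : κ) ^ p * ((τ⁻¹ : κˣ) : κ) ^ q = 1) : p = q := by
  have key : (Polynomial.X ^ (p + 1) : Polynomial κ) = Polynomial.X ^ (q + 1) := by
    apply Polynomial.funext
    intro x
    by_cases hx : x = 0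
    · simp [hx]
    · have := h (Units.mk0 x hx)
      simp only [Units.val_mk0, Units.val_inv_eq_inv_val, inv_pow] at this
      have h2 : x ^ p = x ^ q := by
        rwa [mul_inv_eq_one₀ (pow_ne_zero _ hx)] at this
      simp [pow_succ, h2]
  have := congrArg Polynomial.natDegree key
  simpa using this

/-- If `f` is invariant of weight `(1,-1,0)` over an infinite field `κ`, then for every
commutative `κ`-algebra `A`, every unit `τ ∈ Aˣ` and all points `(a,b,c)`, we have
`f(τ·a, τ⁻¹·b, c) = f(a,b,c)`. -/
theorem eval_invariant_of_weight_invariant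
    {κ : Type*} [Field κ] [Infinite κ] (d₁ d₂ d₃ : ℕ)
    (f : MvPolynomial (Fin d₁ ⊕ Fin d₂ ⊕ Fin d₃) κ)
    (hf : ∀ τ : κˣ, weightScaling d₁ d₂ d₃ τ f = f)
    (A : Type*) [CommRing A] [Algebra κ A] (τ : Aˣ)
    (a : Fin d₁ → A) (b : Fin d₂ → A) (c : Fin d₃ → A) :
    MvPolynomial.aeval
        (Sum.elim (fun i => (τ : A) * a i)
          (Sum.elim (fun j => ((τ⁻¹ : Aˣ) : A) * b j) c)) f =
      MvPolynomial.aeval (Sum.elim a (Sum.elim b c)) f := by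
  conv_lhs => rw [f.as_sum]
  conv_rhs => rw [f.as_sum]
  rw [map_sum, map_sum]
  refine Finset.sum_congr rfl fun m hm => ?_
  rw [aeval_scale_monomial]
  have hpq := exponents_eq (κ := κ) (∑ i, m (Sum.inl i)) (∑ j, m (Sum.inr (Sum.inl j))) (by
    intro t
    have h := coeff_weightScaling d₁ d₂ d₃ t f m
    rw [hf t] at h
    exact mul_right_cancel₀ (mem_support_iff.mp hm) (by rw [one_mul]; exact h.symm))
  rw [hpq, ← mul_pow, Units.mul_inv, one_pow, one_mul]
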